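/- For all i, j ∈ I and all integers m ≥ 1, the operators on U⁺ satisfy ∂_i^m ∘ E_j = r^{−m⟨α_j,α_i⟩} s^{m⟨α_i,α_j⟩} E_j ∘ ∂_i^m + δ_{ij} (m)_{r_i^{−1} s_i} ∂_i^{m−1} and ∂_i'^m ∘ E_j = r^{m⟨α_i,α_j⟩} s^{−m⟨α_j,α_i⟩} E_j ∘ ∂_i'^m + δ_{ij} (m)_{r_i s_i^{−1}} ∂_i'^{m−1}, where E_j : U⁺ → U⁺ is left multiplication by e_j and (m)_v = 1 + v + ⋯ + v^{m−1}. -/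

import Mathlib

noncomputable section

/-- The q-integer `(m)_v = 1 + v + ⋯ + v^{m-1}`. -/
def qnat {K : Type} [CommRing K] (v : K) (m : ℕ) : K := ∑ i ∈ Finset.range m, v ^ i

/-- The Gaussian binomial coefficient `binom(m,k)_v`, as a polynomial expression in `v`
(defined through the Pascal-type recurrence). -/
def qbinom {K : Type} [CommRing K] (v : K) : ℕ → ℕ → K
  | _, 0 => 1
  | 0, _ + 1 => 0
  | m + 1, k + 1 => qbinom v m k + v ^ (k + 1) * qbinom v m (k + 1)

/-- The Euler (Ringel) form on basis elements: `⟨α_i, α_j⟩ = d_i a_{ij}` if `i < j`,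
`d_i` if `i = j`, and `0` if `i > j`. -/
def eulB {n : ℕ} (a : Fin n → Fin n → ℤ) (d : Fin n → ℤ) (i j : Fin n) : ℤ :=
  if i < j then d i * a i j else if i = j then d i else 0

/-- The Euler form on the root lattice `Q = Fin n → ℤ` (coordinates in the basis `α_i`). -/
def euler {n : ℕ} (a : Fin n → Fin n → ℤ) (d : Fin n → ℤ) (μ ν : Fin n → ℤ) : ℤ :=
  ∑ i, ∑ j, μ i * ν j * eulB a d i j

/-- The coefficient `c^{(k)}_{ij} = (r_i s_i⁻¹)^{k(k-1)/2} r^{k⟨α_j,α_i⟩} s^{-k⟨α_i,α_j⟩}`. -/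
def ccoef {K : Type} [Field K] {n : ℕ} (a : Fin n → Fin n → ℤ) (d : Fin n → ℤ)
    (r s : K) (i j : Fin n) (k : ℕ) : K :=
  (r ^ d i * (s ^ d i)⁻¹) ^ (k * (k - 1) / 2) *
    r ^ ((k : ℤ) * eulB a d j i) * (s ^ ((k : ℤ) * eulB a d i j))⁻¹

/-- The `(r,s)`-Serre element
`∑_{k=0}^{1-a_{ij}} (-1)^k binom(1-a_{ij},k)_{r_i s_i⁻¹} c^{(k)}_{ij} E_i^{1-a_{ij}-k} E_j E_i^k`. -/
def serreElt {K : Type} [Field K] {n : ℕ} (a : Fin n → Fin n → ℤ) (d : Fin n → ℤ)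
    (r s : K) {A : Type} [Ring A] [Algebra K A] (E : Fin n → A) (i j : Fin n) : A :=
  ∑ k ∈ Finset.range ((1 - a i j).toNat + 1),
    ((-1 : K) ^ k * qbinom (r ^ d i * (s ^ d i)⁻¹) ((1 - a i j).toNat) k *
        ccoef a d r s i j k) •
      (E i ^ ((1 - a i j).toNat - k) * E j * E i ^ k)

/-- The defining relations of `U⁺_{r,s}`: the `(r,s)`-Serre relations. -/
inductive SerreRel (K : Type) [Field K] {n : ℕ} (a : Fin n → Fin n → ℤ) (d : Fin n → ℤ)
    (r s : K) : FreeAlgebra K (Fin n) → FreeAlgebra K (Fin n) → Prop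
  | rel (i j : Fin n) (h : i ≠ j) :
      SerreRel K a d r s (serreElt a d r s (FreeAlgebra.ι K) i j) 0

/-- `U⁺_{r,s}`: the algebra generated by the `e_i` subject only to the `(r,s)`-Serre
relations. -/
abbrev Uplus (K : Type) [Field K] {n : ℕ} (a : Fin n → Fin n → ℤ) (d : Fin n → ℤ)
    (r s : K) : Type := RingQuot (SerreRel K a d r s)

/-- The generator `e_i` of `U⁺_{r,s}`. -/
def eP (K : Type) [Field K] {n : ℕ} (a : Fin n → Fin n → ℤ) (d : Fin n → ℤ)
    (r s : K) (i : Fin n) : Uplus K a d r s :=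
  RingQuot.mkAlgHom K (SerreRel K a d r s) (FreeAlgebra.ι K i)

/-- The degree-`μ` homogeneous component of `U⁺_{r,s}` for `μ ∈ Q⁺`: the span of the
monomials in the `e_i` in which `e_i` occurs exactly `μ i` times. -/
def UplusDeg (K : Type) [Field K] {n : ℕ} (a : Fin n → Fin n → ℤ) (d : Fin n → ℤ)
    (r s : K) (μ : Fin n → ℕ) : Submodule K (Uplus K a d r s) :=
  Submodule.span K
    {x | ∃ w : List (Fin n), (∀ i, w.count i = μ i) ∧ x = (w.map (eP K a d r s)).prod}


/-- The `(r,s)`-Serre element for the negative generators: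
`∑_{k=0}^{1-a_{ij}} (-1)^k binom(1-a_{ij},k)_{r_i s_i⁻¹} c^{(k)}_{ij} F_i^k F_j F_i^{1-a_{ij}-k}`. -/
def serreEltF {K : Type} [Field K] {n : ℕ} (a : Fin n → Fin n → ℤ) (d : Fin n → ℤ)
    (r s : K) {A : Type} [Ring A] [Algebra K A] (F : Fin n → A) (i j : Fin n) : A :=
  ∑ k ∈ Finset.range ((1 - a i j).toNat + 1),
    ((-1 : K) ^ k * qbinom (r ^ d i * (s ^ d i)⁻¹) ((1 - a i j).toNat) k *
        ccoef a d r s i j k) •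
      (F i ^ k * F j * F i ^ ((1 - a i j).toNat - k))

/-- The field `ℚ(r,s)` of rational functions in two variables over `ℚ`. -/
abbrev K2 : Type := FractionRing (MvPolynomial (Fin 2) ℚ)

/-- The parameter `r ∈ ℚ(r,s)`. -/
def rr : K2 := algebraMap (MvPolynomial (Fin 2) ℚ) K2 (MvPolynomial.X 0)

/-- The parameter `s ∈ ℚ(r,s)`. -/
def ss : K2 := algebraMap (MvPolynomial (Fin 2) ℚ) K2 (MvPolynomial.X 1)

/-- Generators of the two-parameter quantum group `U_{r,s}(𝔤)`:
`e_i, f_i, ω_i^{±1}, ω_i'^{±1}`. -/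
inductive Gen (n : ℕ) : Type
  | e (i : Fin n) : Gen n
  | f (i : Fin n) : Gen n
  | w (i : Fin n) : Gen n
  | winv (i : Fin n) : Gen n
  | w' (i : Fin n) : Gen n
  | w'inv (i : Fin n) : Gen n

/-- The four toral generators `ω_i, ω_i^{-1}, ω_i', ω_i'^{-1}` attached to `i`. -/
def tor {n : ℕ} (i : Fin n) : Bool → Bool → Gen n
  | false, false => Gen.w i
  | false, true => Gen.winv i
  | true, false => Gen.w' i
  | true, true => Gen.w'inv i

/-- The defining relations (R1)–(R6) of the two-parameter quantum group `U_{r,s}(𝔤)`. -/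
inductive URel {n : ℕ} (a : Fin n → Fin n → ℤ) (d : Fin n → ℤ) :
    FreeAlgebra K2 (Gen n) → FreeAlgebra K2 (Gen n) → Prop
  | torComm (i j : Fin n) (p q p' q' : Bool) :
      URel a d (FreeAlgebra.ι K2 (tor i p q) * FreeAlgebra.ι K2 (tor j p' q'))
        (FreeAlgebra.ι K2 (tor j p' q') * FreeAlgebra.ι K2 (tor i p q))
  | wInvR (i : Fin n) :
      URel a d (FreeAlgebra.ι K2 (Gen.w i) * FreeAlgebra.ι K2 (Gen.winv i)) 1
  | wInvL (i : Fin n) :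
      URel a d (FreeAlgebra.ι K2 (Gen.winv i) * FreeAlgebra.ι K2 (Gen.w i)) 1
  | w'InvR (i : Fin n) :
      URel a d (FreeAlgebra.ι K2 (Gen.w' i) * FreeAlgebra.ι K2 (Gen.w'inv i)) 1
  | w'InvL (i : Fin n) :
      URel a d (FreeAlgebra.ι K2 (Gen.w'inv i) * FreeAlgebra.ι K2 (Gen.w' i)) 1
  | we (i j : Fin n) :
      URel a d (FreeAlgebra.ι K2 (Gen.w i) * FreeAlgebra.ι K2 (Gen.e j))
        ((rr ^ eulB a d j i * (ss ^ eulB a d i j)⁻¹) •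
          (FreeAlgebra.ι K2 (Gen.e j) * FreeAlgebra.ι K2 (Gen.w i)))
  | w'e (i j : Fin n) :
      URel a d (FreeAlgebra.ι K2 (Gen.w' i) * FreeAlgebra.ι K2 (Gen.e j))
        (((rr ^ eulB a d i j)⁻¹ * ss ^ eulB a d j i) •
          (FreeAlgebra.ι K2 (Gen.e j) * FreeAlgebra.ι K2 (Gen.w' i)))
  | wf (i j : Fin n) :
      URel a d (FreeAlgebra.ι K2 (Gen.w i) * FreeAlgebra.ι K2 (Gen.f j))
        (((rr ^ eulB a d j i)⁻¹ * ss ^ eulB a d i j) •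
          (FreeAlgebra.ι K2 (Gen.f j) * FreeAlgebra.ι K2 (Gen.w i)))
  | w'f (i j : Fin n) :
      URel a d (FreeAlgebra.ι K2 (Gen.w' i) * FreeAlgebra.ι K2 (Gen.f j))
        ((rr ^ eulB a d i j * (ss ^ eulB a d j i)⁻¹) •
          (FreeAlgebra.ι K2 (Gen.f j) * FreeAlgebra.ι K2 (Gen.w' i)))
  | ef (i j : Fin n) :
      URel a d
        (FreeAlgebra.ι K2 (Gen.e i) * FreeAlgebra.ι K2 (Gen.f j) -
          FreeAlgebra.ι K2 (Gen.f j) * FreeAlgebra.ι K2 (Gen.e i))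
        (if i = j then
          ((rr ^ d i - ss ^ d i)⁻¹) •
            (FreeAlgebra.ι K2 (Gen.w i) - FreeAlgebra.ι K2 (Gen.w' i))
         else 0)
  | serreE (i j : Fin n) (h : i ≠ j) :
      URel a d (serreElt a d rr ss (fun k => FreeAlgebra.ι K2 (Gen.e k)) i j) 0
  | serreF (i j : Fin n) (h : i ≠ j) :
      URel a d (serreEltF a d rr ss (fun k => FreeAlgebra.ι K2 (Gen.f k)) i j) 0

/-- The two-parameter quantum group `U_{r,s}(𝔤)` over `ℚ(r,s)`. -/
abbrev Uq {n : ℕ} (a : Fin n → Fin n → ℤ) (d : Fin n → ℤ) : Type :=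
  RingQuot (URel a d)

/-- The image of a generator in `U_{r,s}(𝔤)`. -/
def gU {n : ℕ} (a : Fin n → Fin n → ℤ) (d : Fin n → ℤ) (x : Gen n) : Uq a d :=
  RingQuot.mkAlgHom K2 (URel a d) (FreeAlgebra.ι K2 x)

/-- The subalgebra `U⁺` of `U_{r,s}(𝔤)` generated by the `e_i`. -/
def Upos {n : ℕ} (a : Fin n → Fin n → ℤ) (d : Fin n → ℤ) : Subalgebra K2 (Uq a d) :=
  Algebra.adjoin K2 (Set.range fun i => gU a d (Gen.e i))

/-- The subalgebra `U⁻` of `U_{r,s}(𝔤)` generated by the `f_i`. -/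
def Uneg {n : ℕ} (a : Fin n → Fin n → ℤ) (d : Fin n → ℤ) : Subalgebra K2 (Uq a d) :=
  Algebra.adjoin K2 (Set.range fun i => gU a d (Gen.f i))

/-- The subalgebra `U⁰` of `U_{r,s}(𝔤)` generated by the `ω_i^{±1}, ω_i'^{±1}`. -/
def Uzero {n : ℕ} (a : Fin n → Fin n → ℤ) (d : Fin n → ℤ) : Subalgebra K2 (Uq a d) :=
  Algebra.adjoin K2 (Set.range fun p : Fin n × Bool × Bool => gU a d (tor p.1 p.2.1 p.2.2))

/-- The generator `e_i` of `U⁺ ⊆ U_{r,s}(𝔤)`, as an element of the subalgebra `U⁺`. -/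
def eUp {n : ℕ} (a : Fin n → Fin n → ℤ) (d : Fin n → ℤ) (i : Fin n) : ↥(Upos a d) :=
  ⟨gU a d (Gen.e i), Algebra.subset_adjoin (Set.mem_range_self i)⟩

/-- `m ↦ (m)_v` satisfies `(m + k)_v = (m)_v + v^m (k)_v`. -/
lemma qnat_add {K : Type} [CommRing K] (v : K) (m k : ℕ) :
    qnat v (m + k) = qnat v m + v ^ m * qnat v k := by
  simp only [qnat, Finset.sum_range_add, Finset.mul_sum, pow_add]

lemma qnat_succ {K : Type} [CommRing K] (v : K) (m : ℕ) :
    qnat v (m + 1) = qnat v m + v ^ m :=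
  Finset.sum_range_succ _ _

lemma qnat_inv {K : Type} [Field K] {v : K} (hv : v ≠ 0) (m : ℕ) :
    qnat v (m + 1) = v ^ m * qnat v⁻¹ (m + 1) := by
  rw [qnat, qnat, Finset.mul_sum, ← Finset.sum_range_reflect]
  refine Finset.sum_congr rfl fun l hl => ?_
  have hl : l ≤ m := Nat.lt_succ_iff.mp (Finset.mem_range.mp hl)
  rw [show m + 1 - 1 - l = m - l by omega, pow_sub₀ _ hv hl, inv_pow]

lemma qbinom_zero_right {K : Type} [CommRing K] (v : K) (m : ℕ) : qbinom v m 0 = 1 := by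
  cases m <;> rfl

lemma qbinom_succ_succ {K : Type} [CommRing K] (v : K) (m k : ℕ) :
    qbinom v (m + 1) (k + 1) = qbinom v m k + v ^ (k + 1) * qbinom v m (k + 1) := rfl

lemma qbinom_eq_zero {K : Type} [CommRing K] (v : K) :
    ∀ {m k : ℕ}, m < k → qbinom v m k = 0
  | _, 0, h => absurd h (Nat.not_lt_zero _)
  | 0, _ + 1, _ => rfl
  | m + 1, k + 1, h => by
    rw [qbinom_succ_succ, qbinom_eq_zero v (by omega : m < k),
      qbinom_eq_zero v (by omega : m < k + 1)]
    ring

lemma qbinom_succ_mul_qnat {K : Type} [CommRing K] (v : K) :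
    ∀ m k t : ℕ, k + t = m →
      qbinom v m (k + 1) * qnat v (k + 1) = qbinom v m k * qnat v t
  | 0, k, t, h => by
    obtain ⟨rfl, rfl⟩ : k = 0 ∧ t = 0 := by omega
    simp [qbinom, qnat]
  | m + 1, k, 0, h => by
    rw [qbinom_eq_zero v (by omega : m + 1 < k + 1)]
    simp [qnat]
  | m + 1, 0, t + 1, h => by
    obtain rfl : t = m := by omega
    have ih := qbinom_succ_mul_qnat v t 0 t (by omega)
    have h1 := qnat_add v 1 t
    simp only [qbinom_succ_succ, qbinom_zero_right, zero_add, pow_one] at ih ⊢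
    rw [add_comm t 1, h1]
    linear_combination v * ih
  | m + 1, k + 1, t + 1, h => by
    have ih₁ := qbinom_succ_mul_qnat v m (k + 1) t (by omega)
    have ih₂ := qbinom_succ_mul_qnat v m k (t + 1) (by omega)
    have h1 := qnat_add v (k + 1 + 1) t
    have h2 := qnat_add v (k + 1) (t + 1)
    rw [show k + 1 + 1 + t = k + 1 + (t + 1) by omega] at h1
    rw [qbinom_succ_succ v m (k + 1), qbinom_succ_succ v m k]
    linear_combination v ^ (k + 1 + 1) * ih₁ + ih₂ + qbinom v m (k + 1) * (h2 - h1)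

lemma triangle_succ (k : ℕ) : (k + 1) * (k + 1 - 1) / 2 = k * (k - 1) / 2 + k := by
  rw [← Nat.choose_two_right, ← Nat.choose_two_right, Nat.choose_succ_succ' k 1,
    Nat.choose_one_right, add_comm]

/-- The `q`-binomial theorem. -/
lemma sum_qbinom_eq_prod {K : Type} [CommRing K] (v : K) (N : ℕ) (z : K) :
    ∑ k ∈ Finset.range (N + 1), (-1) ^ k * qbinom v N k * v ^ (k * (k - 1) / 2) * z ^ k =
      ∏ l ∈ Finset.range N, (1 - v ^ l * z) := by
  induction N generalizing z with
  | zero => simp [qbinom]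
  | succ N ih =>
    rw [Finset.prod_range_succ']
    have h : ∏ l ∈ Finset.range N, (1 - v ^ (l + 1) * z) =
        ∏ l ∈ Finset.range N, (1 - v ^ l * (v * z)) :=
      Finset.prod_congr rfl fun l _ => by ring
    rw [h, ← ih, Finset.sum_range_succ', pow_zero, one_mul, mul_sub, mul_one]
    have h1 : ∀ k, (-1) ^ (k + 1) * qbinom v (N + 1) (k + 1) *
          v ^ ((k + 1) * (k + 1 - 1) / 2) * z ^ (k + 1) =
        (-1) ^ (k + 1) * qbinom v N (k + 1) * v ^ ((k + 1) * (k + 1 - 1) / 2) *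
            (v * z) ^ (k + 1) -
          (-1) ^ k * qbinom v N k * v ^ (k * (k - 1) / 2) * (v * z) ^ k * z := fun k => by
      rw [qbinom_succ_succ, triangle_succ]; ring
    simp only [h1]
    rw [Finset.sum_sub_distrib, ← Finset.sum_mul, Finset.sum_range_succ (fun k =>
      (-1) ^ (k + 1) * qbinom v N (k + 1) * v ^ ((k + 1) * (k + 1 - 1) / 2) * (v * z) ^ (k + 1)),
      qbinom_eq_zero v (by omega : N < N + 1), Finset.sum_range_succ' (fun k =>
      (-1) ^ k * qbinom v N k * v ^ (k * (k - 1) / 2) * (v * z) ^ k) N]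
    simp only [qbinom_zero_right]
    ring

section commutators

variable {K A : Type} [Field K] [Ring A] [Algebra K A]

lemma mul_pow_of_skew {x W : A} {p : K} (h : W * x = p • (x * W)) (m : ℕ) :
    W * x ^ m = p ^ m • (x ^ m * W) := by
  induction m with
  | zero => simp
  | succ m ih =>
    rw [pow_succ, ← mul_assoc, ih, smul_mul_assoc, mul_assoc, h, mul_smul_comm, smul_smul,
      ← mul_assoc, pow_succ]

lemma pow_mul_sub_mul_pow {x F W W' : A} {p p' : K} (h : x * F - F * x = W + W')
    (hW : W * x = p • (x * W)) (hW' : W' * x = p' • (x * W')) (m : ℕ) :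
    x ^ m * F - F * x ^ m =
      qnat p m • (x ^ (m - 1) * W) + qnat p' m • (x ^ (m - 1) * W') := by
  induction m with
  | zero => simp [qnat]
  | succ m ih =>
    have h1 : x ^ (m + 1) * F - F * x ^ (m + 1) =
        x * (x ^ m * F - F * x ^ m) + (x * F - F * x) * x ^ m := by
      rw [pow_succ']; noncomm_ring
    have h2 : ∀ (c : K) (V : A), x * (qnat c m • (x ^ (m - 1) * V)) = qnat c m • (x ^ m * V) := by
      intro c V
      rcases m with _ | m
      · simp [qnat]
      · rw [mul_smul_comm, ← mul_assoc, Nat.add_sub_cancel, ← pow_succ']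
    rw [h1, ih, h, mul_add, h2, h2, add_mul, mul_pow_of_skew hW, mul_pow_of_skew hW',
      Nat.add_sub_cancel, qnat_succ, qnat_succ, add_smul, add_smul]
    abel

lemma sum_telescope {x y W : A} {p q : K} {N : ℕ} {b : ℕ → K}
    (hx : W * x = p • (x * W)) (hy : W * y = q • (y * W))
    (hb : ∀ k < N, b (k + 1) * qnat p (k + 1) + b k * qnat p (N - k) * q * p ^ k = 0) :
    ∑ k ∈ Finset.range (N + 1), b k •
      (x ^ (N - k) * y * (qnat p k • (x ^ (k - 1) * W)) +
        qnat p (N - k) • (x ^ (N - k - 1) * W) * (y * x ^ k)) = 0 := by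
  have h : ∀ k, x ^ (N - k - 1) * W * (y * x ^ k) =
      (q * p ^ k) • (x ^ (N - k - 1) * y * x ^ k * W) := fun k => by
    rw [mul_assoc, ← mul_assoc W, hy, smul_mul_assoc, mul_assoc y, mul_pow_of_skew hx]
    simp only [mul_smul_comm, smul_smul, mul_assoc]
  simp only [smul_add, Finset.sum_add_distrib, smul_mul_assoc, h]
  rw [Finset.sum_range_succ', Finset.sum_range_succ]
  simp only [Nat.sub_self, qnat, Finset.range_zero, Finset.sum_empty, zero_smul, mul_zero,
    smul_zero, add_zero]
  rw [← Finset.sum_add_distrib]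
  refine Finset.sum_eq_zero fun k hk => ?_
  have hk := hb k (Finset.mem_range.mp hk)
  simp only [qnat] at hk
  rw [Nat.add_sub_cancel, show N - k - 1 = N - (k + 1) by omega, mul_smul_comm, smul_smul,
    smul_smul, smul_smul, ← mul_assoc, ← add_smul,
    ← zero_smul K (x ^ (N - (k + 1)) * y * x ^ k * W), ← hk]
  congr 1
  ring

/-- A sum of the shape of a Serre element commutes with an element whose bracket with `x` is a sum
of two skew-commuting elements. -/
lemma commute_sum_of_left {x y F W W' : A} {p q p' q' : K} {N : ℕ} {b : ℕ → K}
    (h : x * F - F * x = W + W') (h' : Commute y F)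
    (hx : W * x = p • (x * W)) (hy : W * y = q • (y * W))
    (hx' : W' * x = p' • (x * W')) (hy' : W' * y = q' • (y * W'))
    (hb : ∀ k < N, b (k + 1) * qnat p (k + 1) + b k * qnat p (N - k) * q * p ^ k = 0)
    (hb' : ∀ k < N, b (k + 1) * qnat p' (k + 1) + b k * qnat p' (N - k) * q' * p' ^ k = 0) :
    Commute (∑ k ∈ Finset.range (N + 1), b k • (x ^ (N - k) * y * x ^ k)) F := by
  rw [Commute, SemiconjBy, ← sub_eq_zero, Finset.sum_mul, Finset.mul_sum,
    ← Finset.sum_sub_distrib]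
  have key : ∀ k, b k • (x ^ (N - k) * y * x ^ k) * F - F * b k • (x ^ (N - k) * y * x ^ k) =
      b k • (x ^ (N - k) * y * (qnat p k • (x ^ (k - 1) * W)) +
        qnat p (N - k) • (x ^ (N - k - 1) * W) * (y * x ^ k)) +
      b k • (x ^ (N - k) * y * (qnat p' k • (x ^ (k - 1) * W')) +
        qnat p' (N - k) • (x ^ (N - k - 1) * W') * (y * x ^ k)) := fun k => by
    rw [smul_mul_assoc, mul_smul_comm, ← smul_sub, ← smul_add]
    congr 1
    have e : x ^ (N - k) * y * x ^ k * F - F * (x ^ (N - k) * y * x ^ k) =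
        x ^ (N - k) * y * (x ^ k * F - F * x ^ k) +
          (x ^ (N - k) * F - F * x ^ (N - k)) * (y * x ^ k) +
          x ^ (N - k) * (y * F - F * y) * x ^ k := by noncomm_ring
    rw [e, pow_mul_sub_mul_pow h hx hx', pow_mul_sub_mul_pow h hx hx', h'.eq]
    noncomm_ring
  simp only [key]
  rw [Finset.sum_add_distrib, sum_telescope hx hy hb, sum_telescope hx' hy' hb', add_zero]

/-- A sum of the shape of a Serre element commutes with an element whose bracket with `y` is a sum
of two skew-commuting elements. -/
lemma commute_sum_of_middle {x y F W W' : A} {p p' : K} {N : ℕ} {b : ℕ → K}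
    (h : y * F - F * y = W + W') (h' : Commute x F)
    (hx : W * x = p • (x * W)) (hx' : W' * x = p' • (x * W'))
    (hb : ∑ k ∈ Finset.range (N + 1), b k * p ^ k = 0)
    (hb' : ∑ k ∈ Finset.range (N + 1), b k * p' ^ k = 0) :
    Commute (∑ k ∈ Finset.range (N + 1), b k • (x ^ (N - k) * y * x ^ k)) F := by
  rw [Commute, SemiconjBy, ← sub_eq_zero, Finset.sum_mul, Finset.mul_sum,
    ← Finset.sum_sub_distrib]
  have key : ∀ k ∈ Finset.range (N + 1),
      b k • (x ^ (N - k) * y * x ^ k) * F - F * b k • (x ^ (N - k) * y * x ^ k) =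
      (b k * p ^ k) • (x ^ N * W) + (b k * p' ^ k) • (x ^ N * W') := fun k hk => by
    have hk : k ≤ N := Nat.lt_succ_iff.mp (Finset.mem_range.mp hk)
    have e : x ^ (N - k) * y * x ^ k * F - F * (x ^ (N - k) * y * x ^ k) =
        x ^ (N - k) * ((W + W') * x ^ k) := by
      rw [mul_assoc _ _ F, (h'.pow_left k).eq, ← mul_assoc F, ← mul_assoc F,
        ← (h'.pow_left (N - k)).eq, ← h]
      noncomm_ring
    rw [smul_mul_assoc, mul_smul_comm, ← smul_sub, e, add_mul, mul_pow_of_skew hx,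
      mul_pow_of_skew hx', mul_add, mul_smul_comm, mul_smul_comm, ← mul_assoc, ← mul_assoc,
      ← pow_add, Nat.sub_add_cancel hk, smul_add, smul_smul, smul_smul]
  rw [Finset.sum_congr rfl key, Finset.sum_add_distrib, ← Finset.sum_smul, ← Finset.sum_smul,
    hb, hb', zero_smul, zero_smul, add_zero]

end commutators

section serre

variable {K : Type} [Field K] {n : ℕ} (a : Fin n → Fin n → ℤ) (d : Fin n → ℤ) (r s : K)

/-- The scalar by which `ω_i` skew-commutes with `e_j`. -/
def omegaChar (i j : Fin n) : K := r ^ eulB a d j i * (s ^ eulB a d i j)⁻¹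

/-- The scalar by which `ω_i'` skew-commutes with `e_j`. -/
def omegaChar' (i j : Fin n) : K := (r ^ eulB a d i j)⁻¹ * s ^ eulB a d j i

variable {a d r s}

lemma eulB_self (i : Fin n) : eulB a d i i = d i := by simp [eulB]

lemma eulB_add_eulB (hsym : ∀ i j, d i * a i j = d j * a j i) {i j : Fin n} (h : i ≠ j) :
    eulB a d i j + eulB a d j i = d i * a i j := by
  rcases lt_or_gt_of_ne h with h' | h'
  · simp [eulB, h', h'.not_gt, h.symm]
  · simp [eulB, h', h'.not_gt, h, hsym i j]

lemma omegaChar_ne_zero (hr : r ≠ 0) (hs : s ≠ 0) (i j : Fin n) : omegaChar a d r s i j ≠ 0 :=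
  mul_ne_zero (zpow_ne_zero _ hr) (inv_ne_zero (zpow_ne_zero _ hs))

lemma omegaChar'_ne_zero (hr : r ≠ 0) (hs : s ≠ 0) (i j : Fin n) : omegaChar' a d r s i j ≠ 0 :=
  mul_ne_zero (inv_ne_zero (zpow_ne_zero _ hr)) (zpow_ne_zero _ hs)

lemma omegaChar_self (i : Fin n) : omegaChar a d r s i i = r ^ d i * (s ^ d i)⁻¹ := by
  rw [omegaChar, eulB_self]

lemma omegaChar'_self (i : Fin n) :
    omegaChar' a d r s i i = (r ^ d i * (s ^ d i)⁻¹)⁻¹ := by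
  rw [omegaChar', eulB_self, mul_inv, inv_inv]

lemma omegaChar_mul_omegaChar' (hr : r ≠ 0) (hs : s ≠ 0) (i j : Fin n) :
    omegaChar a d r s i j * omegaChar' a d r s j i = 1 := by
  have := zpow_ne_zero (eulB a d j i) hr
  have := zpow_ne_zero (eulB a d i j) hs
  rw [omegaChar, omegaChar']
  field_simp

lemma omegaChar_mul_omegaChar (hr : r ≠ 0) (hs : s ≠ 0)
    (hsym : ∀ i j, d i * a i j = d j * a j i) {i j : Fin n} (h : i ≠ j) (ha : a i j ≤ 0) :
    omegaChar a d r s i j * omegaChar a d r s j i *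
      (r ^ d i * (s ^ d i)⁻¹) ^ ((1 - a i j).toNat - 1) = 1 := by
  obtain ⟨c, hc⟩ : ∃ c : ℕ, a i j = -c := ⟨(-a i j).toNat, by omega⟩
  have e : omegaChar a d r s i j * omegaChar a d r s j i = (r * s⁻¹) ^ (d i * a i j) := by
    rw [← eulB_add_eulB hsym h, omegaChar, omegaChar, mul_zpow, zpow_add₀ hr, inv_zpow,
      zpow_add₀ hs, mul_inv]
    ring
  have e2 : r ^ d i * (s ^ d i)⁻¹ = (r * s⁻¹) ^ d i := by rw [mul_zpow, inv_zpow]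
  have hrs : r * s⁻¹ ≠ 0 := mul_ne_zero hr (inv_ne_zero hs)
  rw [e, e2, ← zpow_natCast, ← zpow_mul, ← zpow_add₀ hrs, hc,
    show d i * -(c : ℤ) + d i * (((1 - -(c : ℤ)).toNat - 1 : ℕ) : ℤ) = 0 by
      rw [show (1 - -(c : ℤ)).toNat - 1 = c by omega]; ring, zpow_zero]

lemma ccoef_eq (i j : Fin n) (k : ℕ) :
    ccoef a d r s i j k =
      (r ^ d i * (s ^ d i)⁻¹) ^ (k * (k - 1) / 2) * omegaChar a d r s i j ^ k := by
  rw [ccoef, omegaChar, mul_comm (k : ℤ), mul_comm (k : ℤ), zpow_mul, zpow_mul, zpow_natCast,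
    zpow_natCast, mul_pow (r ^ eulB a d j i), inv_pow, mul_assoc]

lemma serreElt_map {A B : Type} [Ring A] [Algebra K A] [Ring B] [Algebra K B] (φ : A →ₐ[K] B)
    (E : Fin n → A) (i j : Fin n) :
    φ (serreElt a d r s E i j) = serreElt a d r s (fun l => φ (E l)) i j := by
  simp [serreElt, map_sum]

lemma serreElt_smul {A : Type} [Ring A] [Algebra K A] (E : Fin n → A) (χ : Fin n → K)
    (i j : Fin n) :
    serreElt a d r s (fun l => χ l • E l) i j =
      (χ i ^ (1 - a i j).toNat * χ j) • serreElt a d r s E i j := by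
  rw [serreElt, serreElt, Finset.smul_sum]
  refine Finset.sum_congr rfl fun k hk => ?_
  have hk : k ≤ (1 - a i j).toNat := Nat.lt_succ_iff.mp (Finset.mem_range.mp hk)
  simp only [smul_pow, smul_mul_assoc, mul_smul_comm, smul_smul]
  congr 1
  nth_rw 3 [← Nat.sub_add_cancel hk]
  rw [pow_add]
  ring

/-- Serre elements commute with any `F` whose brackets with the `E l` are those of `f_k`. -/
lemma serreElt_commute (hr : r ≠ 0) (hs : s ≠ 0) (hsym : ∀ i j, d i * a i j = d j * a j i)
    {A : Type} [Ring A] [Algebra K A] {E : Fin n → A} {k : Fin n} {F W W' : A}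
    (hF : ∀ l, E l * F - F * E l = if l = k then W + W' else 0)
    (hW : ∀ l, W * E l = omegaChar a d r s k l • (E l * W))
    (hW' : ∀ l, W' * E l = omegaChar' a d r s k l • (E l * W'))
    {i j : Fin n} (hij : i ≠ j) (ha : a i j ≤ 0) :
    Commute (serreElt a d r s E i j) F := by
  have hcomm : ∀ l, l ≠ k → Commute (E l) F := fun l hl => by
    have := hF l
    rwa [if_neg hl, sub_eq_zero] at this
  have hv : r ^ d i * (s ^ d i)⁻¹ ≠ 0 :=
    mul_ne_zero (zpow_ne_zero _ hr) (inv_ne_zero (zpow_ne_zero _ hs))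
  have hN := omegaChar_mul_omegaChar hr hs hsym hij ha
  obtain ⟨N, hN'⟩ : ∃ N : ℕ, (1 - a i j).toNat = N + 1 := ⟨(-a i j).toNat, by omega⟩
  rw [serreElt]
  simp only [ccoef_eq]
  rw [hN'] at hN ⊢
  rw [Nat.add_sub_cancel] at hN
  have hτ := omegaChar_mul_omegaChar' (a := a) (d := d) hr hs i j
  have hτ' := omegaChar_mul_omegaChar' (a := a) (d := d) hr hs j i
  have hsum := sum_qbinom_eq_prod (r ^ d i * (s ^ d i)⁻¹) (N + 1)
  have hvi := omegaChar_self (a := a) (d := d) (r := r) (s := s) i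
  have hvi' := omegaChar'_self (a := a) (d := d) (r := r) (s := s) i
  generalize r ^ d i * (s ^ d i)⁻¹ = v at *
  by_cases hi : i = k
  · subst hi
    refine commute_sum_of_left (by simpa using hF i) (hcomm j hij.symm) (hW i) (hW j) (hW' i)
      (hW' j) (fun m hm => ?_) (fun m hm => ?_)
    · have key := qbinom_succ_mul_qnat v (N + 1) m (N + 1 - m) (by omega)
      rw [hvi, triangle_succ, pow_add, pow_succ (-1 : K), pow_succ (omegaChar a d r s i j)]
      linear_combination (-(-1) ^ m * v ^ (m * (m - 1) / 2) * v ^ m *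
        omegaChar a d r s i j ^ m * omegaChar a d r s i j) * key
    · have key := qbinom_succ_mul_qnat v (N + 1) m (N + 1 - m) (by omega)
      obtain ⟨t, ht⟩ : ∃ t, N + 1 - m = t + 1 := ⟨N - m, by omega⟩
      obtain rfl : N = m + t := by omega
      rw [ht, qnat_inv hv, qnat_inv hv] at key
      have hq : omegaChar' a d r s i j = omegaChar a d r s i j * v ^ (m + t) := by
        linear_combination (-omegaChar' a d r s i j) * hN +
          omegaChar a d r s i j * v ^ (m + t) * hτ'
      rw [hvi', triangle_succ, pow_add, pow_succ (-1 : K), pow_succ (omegaChar a d r s i j), hq,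
        ht, pow_add v m t]
      have hm : v ^ m * v⁻¹ ^ m = 1 := by rw [← mul_pow, mul_inv_cancel₀ hv, one_pow]
      linear_combination (-(-1) ^ m * v ^ (m * (m - 1) / 2) *
        omegaChar a d r s i j ^ m * omegaChar a d r s i j) * key +
        (-1) ^ m * v ^ (m * (m - 1) / 2) * omegaChar a d r s i j ^ m * omegaChar a d r s i j *
        v ^ t * qbinom v (m + t + 1) m * qnat v⁻¹ (t + 1) * hm
  by_cases hj : j = k
  · subst hj
    refine commute_sum_of_middle (by simpa using hF j) (hcomm i hij) (hW i) (hW' i) ?_ ?_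
    · have := hsum (omegaChar a d r s i j * omegaChar a d r s j i)
      rw [Finset.prod_range_succ, mul_comm (v ^ N), hN, sub_self, mul_zero] at this
      rw [← this]
      refine Finset.sum_congr rfl fun m _ => ?_
      rw [mul_pow]; ring
    · have := hsum (omegaChar a d r s i j * omegaChar' a d r s j i)
      rw [Finset.prod_range_succ', pow_zero, one_mul, hτ, sub_self, mul_zero] at this
      rw [← this]
      refine Finset.sum_congr rfl fun m _ => ?_
      have h1 : omegaChar a d r s i j ^ m * omegaChar' a d r s j i ^ m = 1 ^ m := by
        rw [← mul_pow, hτ]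
      rw [← h1]; ring
  · refine Commute.sum_left _ _ _ fun m _ => Commute.smul_left ?_ _
    exact (((hcomm i hi).pow_left _).mul_left (hcomm j hj)).mul_left ((hcomm i hi).pow_left _)

end serre

section skewDerivation

variable {K : Type} [Field K] {n : ℕ}

lemma linearMap_ext_of_adjoin {B V : Type} [Ring B] [Algebra K B] [AddCommGroup V] [Module K V]
    {e : Fin n → B} (he : Algebra.adjoin K (Set.range e) = ⊤) {f g : B →ₗ[K] V}
    (h1 : f 1 = g 1) (h : ∀ l P, f P = g P → f (e l * P) = g (e l * P)) : f = g := by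
  have key : ∀ x ∈ Algebra.adjoin K (Set.range e), ∀ P, f P = g P → f (x * P) = g (x * P) := by
    intro x hx
    induction hx using Algebra.adjoin_induction with
    | mem x hx => obtain ⟨l, rfl⟩ := hx; exact h l
    | algebraMap c => intro P hP; simp [← Algebra.smul_def, hP]
    | add x y _ _ hx hy => intro P hP; simp [add_mul, hx P hP, hy P hP]
    | mul x y _ _ hx hy => intro P hP; rw [mul_assoc]; exact hx _ (hy _ hP)
  ext x
  simpa using key x (he ▸ Algebra.mem_top) 1 h1

/-- The upper triangular matrices whose `(0,1)` entries generate a skew derivation. -/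
def skewMatrix {B : Type} [Ring B] [Algebra K B] (e : Fin n → B) (χ : Fin n → K) (k l : Fin n) :
    Matrix (Fin 2) (Fin 2) B :=
  !![e l, if l = k then 1 else 0; 0, χ l • e l]

lemma exists_skewDerivation_of_algHom {B : Type} [Ring B] [Algebra K B] {e : Fin n → B}
    {χ : Fin n → K} {k : Fin n} (he : Algebra.adjoin K (Set.range e) = ⊤)
    {Ψ : B →ₐ[K] Matrix (Fin 2) (Fin 2) B} (hΨ : ∀ l, Ψ (e l) = skewMatrix e χ k l)
    {T : B →ₐ[K] B} (hT : ∀ l, T (e l) = χ l • e l) :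
    ∃ δ : B →ₗ[K] B, δ 1 = 0 ∧
      (∀ l P, δ (e l * P) = e l * δ P + if l = k then T P else 0) ∧
      ∀ P, Ψ P = !![P, δ P; 0, T P] := by
  let ent (p q : Fin 2) : B →ₗ[K] B := Matrix.entryLinearMap K B p q ∘ₗ Ψ.toLinearMap
  have ent_apply : ∀ p q P, ent p q P = Ψ P p q := fun _ _ _ => rfl
  have h10 : ent 1 0 = 0 := linearMap_ext_of_adjoin he (by simp [ent_apply]) fun l P hP => by
    simp only [ent_apply, LinearMap.zero_apply] at hP ⊢
    simp [hΨ, skewMatrix, Matrix.mul_apply, Fin.sum_univ_two, hP]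
  have h10' : ∀ P, Ψ P 1 0 = 0 := fun P => LinearMap.congr_fun h10 P
  have h00 : ent 0 0 = LinearMap.id :=
    linearMap_ext_of_adjoin he (by simp [ent_apply]) fun l P hP => by
      simp only [ent_apply, LinearMap.id_apply] at hP ⊢
      simp [hΨ, skewMatrix, Matrix.mul_apply, Fin.sum_univ_two, hP, h10']
  have h11 : ent 1 1 = T.toLinearMap :=
    linearMap_ext_of_adjoin he (by simp [ent_apply]) fun l P hP => by
      simp only [ent_apply, AlgHom.toLinearMap_apply] at hP ⊢
      simp [hΨ, hT, skewMatrix, Matrix.mul_apply, Fin.sum_univ_two, hP]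
  have h11' : ∀ P, Ψ P 1 1 = T P := fun P => LinearMap.congr_fun h11 P
  refine ⟨ent 0 1, by simp [ent_apply], fun l P => ?_, fun P => ?_⟩
  · simp [ent_apply, hΨ, skewMatrix, Matrix.mul_apply, Fin.sum_univ_two, h11']
  · ext p q
    fin_cases p <;> fin_cases q
    exacts [LinearMap.congr_fun h00 P, rfl, h10' P, h11' P]

variable {a : Fin n → Fin n → ℤ} {d : Fin n → ℤ} {r s : K}

lemma serreElt_eP {i j : Fin n} (h : i ≠ j) :
    serreElt a d r s (eP K a d r s) i j = 0 := by
  have := RingQuot.mkAlgHom_rel K (SerreRel.rel (K := K) (a := a) (d := d) (r := r) (s := s) i j h)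
  rwa [serreElt_map, map_zero] at this

lemma serreElt_lmul_eP {i j : Fin n} (h : i ≠ j) :
    serreElt a d r s (fun l => Algebra.lmul K _ (eP K a d r s l)) i j = 0 := by
  rw [← serreElt_map, serreElt_eP h, map_zero]

/-- The homomorphism out of `U⁺` attached to elements satisfying the Serre relations. -/
def liftUplus {B : Type} [Ring B] [Algebra K B] (E : Fin n → B)
    (hE : ∀ i j, i ≠ j → serreElt a d r s E i j = 0) : Uplus K a d r s →ₐ[K] B :=
  RingQuot.liftAlgHom K ⟨FreeAlgebra.lift K E, fun _ _ h => by
    obtain ⟨i, j, h⟩ := h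
    simpa [serreElt_map] using hE i j h⟩

lemma liftUplus_eP {B : Type} [Ring B] [Algebra K B] (E : Fin n → B)
    (hE : ∀ i j, i ≠ j → serreElt a d r s E i j = 0) (l : Fin n) :
    liftUplus E hE (eP K a d r s l) = E l := by
  rw [liftUplus, eP, RingQuot.liftAlgHom_mkAlgHom_apply, FreeAlgebra.lift_ι_apply]

lemma adjoin_eP : Algebra.adjoin K (Set.range (eP K a d r s)) = ⊤ := by
  have h := congrArg (Subalgebra.map (RingQuot.mkAlgHom K (SerreRel K a d r s)))
    (FreeAlgebra.adjoin_range_ι K (Fin n))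
  rw [AlgHom.map_adjoin, ← Set.range_comp, Algebra.map_top,
    (AlgHom.range_eq_top _).mpr (RingQuot.mkAlgHom_surjective K _)] at h
  exact h

variable (a d r s) in
/-- The endomorphism of `U⁺` rescaling the generators. -/
def scaleUplus (χ : Fin n → K) : Uplus K a d r s →ₐ[K] Uplus K a d r s :=
  liftUplus (fun l => χ l • eP K a d r s l) fun i j h => by
    rw [serreElt_smul, serreElt_eP h, smul_zero]

lemma scaleUplus_eP (χ : Fin n → K) (l : Fin n) :
    scaleUplus a d r s χ (eP K a d r s l) = χ l • eP K a d r s l :=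
  liftUplus_eP _ _ l

lemma scaleUplus_mul_apply (χ ψ : Fin n → K) (P : Uplus K a d r s) :
    scaleUplus a d r s χ (scaleUplus a d r s ψ P) = scaleUplus a d r s (χ * ψ) P := by
  refine LinearMap.congr_fun (f := (scaleUplus a d r s χ).toLinearMap ∘ₗ
    (scaleUplus a d r s ψ).toLinearMap) (g := (scaleUplus a d r s (χ * ψ)).toLinearMap)
    (linearMap_ext_of_adjoin adjoin_eP (by simp) fun l P hP => ?_) P
  simp only [LinearMap.comp_apply, AlgHom.toLinearMap_apply] at hP ⊢
  simp [scaleUplus_eP, hP, smul_smul, mul_comm]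

lemma scaleUplus_one_apply (P : Uplus K a d r s) : scaleUplus a d r s 1 P = P := by
  refine LinearMap.congr_fun (f := (scaleUplus a d r s 1).toLinearMap) (g := LinearMap.id)
    (linearMap_ext_of_adjoin adjoin_eP (by simp) fun l P hP => ?_) P
  simp only [LinearMap.id_apply, AlgHom.toLinearMap_apply] at hP ⊢
  simp [scaleUplus_eP, hP]

lemma scaleUplus_inv_apply {χ : Fin n → K} (hχ : ∀ l, χ l ≠ 0) (P : Uplus K a d r s) :
    scaleUplus a d r s χ⁻¹ (scaleUplus a d r s χ P) = P := by
  rw [scaleUplus_mul_apply, show χ⁻¹ * χ = 1 from funext fun l => inv_mul_cancel₀ (hχ l),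
    scaleUplus_one_apply]

lemma serreElt_skewMatrix (hr : r ≠ 0) (hs : s ≠ 0)
    (hsym : ∀ i j, d i * a i j = d j * a j i) (hoff : ∀ i j, i ≠ j → a i j ≤ 0) {k : Fin n}
    {χ : Fin n → K} (hχ : χ = omegaChar a d r s k ∨ χ = omegaChar' a d r s k) {i j : Fin n}
    (hij : i ≠ j) : serreElt a d r s (skewMatrix (eP K a d r s) χ k) i j = 0 := by
  let T : FreeAlgebra K (Fin n) →ₐ[K] FreeAlgebra K (Fin n) :=
    FreeAlgebra.lift K fun l => χ l • FreeAlgebra.ι K l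
  have hT : ∀ l, T (FreeAlgebra.ι K l) = χ l • FreeAlgebra.ι K l := fun l => by simp [T]
  let Ψ := FreeAlgebra.lift K (skewMatrix (FreeAlgebra.ι K) χ k)
  have hΨ : ∀ l, Ψ (FreeAlgebra.ι K l) = skewMatrix (FreeAlgebra.ι K) χ k l := fun l => by
    simp [Ψ]
  obtain ⟨δ, hδ1, hδ, hΨδ⟩ :=
    exists_skewDerivation_of_algHom (FreeAlgebra.adjoin_range_ι K (Fin n)) hΨ hT
  let L : FreeAlgebra K (Fin n) →ₐ[K] Module.End K (FreeAlgebra K (Fin n)) :=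
    Algebra.lmul K _
  have hcomm : Commute (serreElt a d r s (fun l => L (FreeAlgebra.ι K l)) i j) δ := by
    have hLδ : ∀ l, L (FreeAlgebra.ι K l) * δ - δ * L (FreeAlgebra.ι K l) =
        if l = k then -T.toLinearMap else 0 := fun l => by
      ext P
      split_ifs with h <;> simp [L, hδ, h]
    have hTL : ∀ l, -T.toLinearMap * L (FreeAlgebra.ι K l) =
        χ l • (L (FreeAlgebra.ι K l) * -T.toLinearMap) := fun l => by
      refine LinearMap.ext fun P => ?_
      simp [L, hT]
    rcases hχ with rfl | rfl
    · exact serreElt_commute (W := -T.toLinearMap) (W' := 0) hr hs hsym (by simpa using hLδ) hTL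
        (by simp) hij (hoff i j hij)
    · exact serreElt_commute (W := 0) (W' := -T.toLinearMap) hr hs hsym (by simpa using hLδ)
        (by simp) hTL hij (hoff i j hij)
  have hδu : δ (serreElt a d r s (FreeAlgebra.ι K) i j) = 0 := by
    rw [← serreElt_map] at hcomm
    have := LinearMap.congr_fun hcomm.eq 1
    simpa [L, hδ1] using this.symm
  let π := RingQuot.mkAlgHom K (SerreRel K a d r s)
  have hπ : skewMatrix (eP K a d r s) χ k =
      fun l => (π.mapMatrix.comp Ψ) (FreeAlgebra.ι K l) := by
    funext l
    ext p q
    rw [AlgHom.comp_apply, hΨ]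
    by_cases h : l = k <;> fin_cases p <;> fin_cases q <;> simp [skewMatrix, π, eP, h]
  rw [hπ, ← serreElt_map, AlgHom.comp_apply, hΨδ, hδu, serreElt_map]
  simp only [hT]
  rw [serreElt_smul]
  have h0 : π (serreElt a d r s (FreeAlgebra.ι K) i j) = 0 := by
    rw [serreElt_map]; exact serreElt_eP hij
  ext p q
  fin_cases p <;> fin_cases q <;> simp [h0]

lemma exists_skewDerivation (hr : r ≠ 0) (hs : s ≠ 0)
    (hsym : ∀ i j, d i * a i j = d j * a j i) (hoff : ∀ i j, i ≠ j → a i j ≤ 0) (k : Fin n)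
    {χ : Fin n → K} (hχ : χ = omegaChar a d r s k ∨ χ = omegaChar' a d r s k) :
    ∃ δ : Uplus K a d r s →ₗ[K] Uplus K a d r s, δ 1 = 0 ∧
      ∀ l P, δ (eP K a d r s l * P) =
        eP K a d r s l * δ P + if l = k then scaleUplus a d r s χ P else 0 := by
  obtain ⟨δ, hδ1, hδ, -⟩ := exists_skewDerivation_of_algHom adjoin_eP
    (liftUplus_eP _ fun i j h => serreElt_skewMatrix hr hs hsym hoff hχ h) (scaleUplus_eP χ)
  exact ⟨δ, hδ1, hδ⟩

lemma skewDerivation_scaleUplus {k : Fin n} {χ : Fin n → K}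
    {δ : Uplus K a d r s →ₗ[K] Uplus K a d r s} (hδ1 : δ 1 = 0)
    (hδ : ∀ l P, δ (eP K a d r s l * P) =
      eP K a d r s l * δ P + if l = k then scaleUplus a d r s χ P else 0)
    (ψ : Fin n → K) (P : Uplus K a d r s) :
    δ (scaleUplus a d r s ψ P) = ψ k • scaleUplus a d r s ψ (δ P) := by
  refine LinearMap.congr_fun (f := δ ∘ₗ (scaleUplus a d r s ψ).toLinearMap)
    (g := ψ k • ((scaleUplus a d r s ψ).toLinearMap ∘ₗ δ))
    (linearMap_ext_of_adjoin adjoin_eP (by simp [hδ1]) fun l P hP => ?_) P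
  simp only [LinearMap.comp_apply, AlgHom.toLinearMap_apply, LinearMap.smul_apply] at hP ⊢
  rw [map_mul, scaleUplus_eP, smul_mul_assoc, map_smul, hδ, hδ, map_add, map_mul, scaleUplus_eP, hP]
  split_ifs with h
  · subst h
    rw [scaleUplus_mul_apply, scaleUplus_mul_apply, mul_comm χ]
    simp only [mul_smul_comm, smul_mul_assoc, smul_add]
  · simp only [mul_smul_comm, smul_mul_assoc, smul_add, map_zero, smul_zero]
    rw [smul_comm]

lemma exists_lowering (hr : r ≠ 0) (hs : s ≠ 0)
    (hsym : ∀ i j, d i * a i j = d j * a j i) (hoff : ∀ i j, i ≠ j → a i j ≤ 0) (z : K)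
    (k : Fin n) :
    ∃ f : Module.End K (Uplus K a d r s), f 1 = 0 ∧
      (∀ l P, eP K a d r s l * f P - f (eP K a d r s l * P) =
        if l = k then (r ^ d k - s ^ d k)⁻¹ • (z • scaleUplus a d r s (omegaChar a d r s k) P -
          scaleUplus a d r s (omegaChar' a d r s k) P) else 0) ∧
      ∀ ψ P, f (scaleUplus a d r s ψ P) = ψ k • scaleUplus a d r s ψ (f P) := by
  obtain ⟨δ, hδ1, hδ⟩ := exists_skewDerivation (r := r) (s := s) hr hs hsym hoff k (Or.inl rfl)
  obtain ⟨δ', hδ1', hδ'⟩ := exists_skewDerivation (r := r) (s := s) hr hs hsym hoff k (Or.inr rfl)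
  have hs := skewDerivation_scaleUplus hδ1 hδ
  have hs' := skewDerivation_scaleUplus hδ1' hδ'
  refine ⟨(r ^ d k - s ^ d k)⁻¹ • δ' + (-((r ^ d k - s ^ d k)⁻¹ * z)) • δ, by simp [hδ1, hδ1'],
    fun l P => ?_, fun ψ P => ?_⟩
  · simp only [LinearMap.add_apply, LinearMap.smul_apply, hδ, hδ', mul_add, mul_smul_comm]
    split_ifs with h <;> module
  · simp only [LinearMap.add_apply, LinearMap.smul_apply, hs, hs', map_add, map_smul]
    module

lemma serreEltF_lowering (hr : r ≠ 0) (hs : s ≠ 0)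
    (hsym : ∀ i j, d i * a i j = d j * a j i) (hoff : ∀ i j, i ≠ j → a i j ≤ 0) {z : Fin n → K}
    {f : Fin n → Module.End K (Uplus K a d r s)} (hf1 : ∀ k, f k 1 = 0)
    (hf : ∀ k l P, eP K a d r s l * f k P - f k (eP K a d r s l * P) =
      if l = k then (r ^ d k - s ^ d k)⁻¹ • (z k • scaleUplus a d r s (omegaChar a d r s k) P -
        scaleUplus a d r s (omegaChar' a d r s k) P) else 0)
    (hfs : ∀ k ψ P, f k (scaleUplus a d r s ψ P) = ψ k • scaleUplus a d r s ψ (f k P))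
    {i j : Fin n} (hij : i ≠ j) : serreEltF a d r s f i j = 0 := by
  let L : Uplus K a d r s →ₐ[K] Module.End K (Uplus K a d r s) := Algebra.lmul K _
  have hop : serreElt a d r s (fun l => MulOpposite.op (f l)) i j =
      MulOpposite.op (serreEltF a d r s f i j) := by
    simp [serreElt, serreEltF, mul_assoc]
  have hcomm : ∀ k, Commute (L (eP K a d r s k)) (serreEltF a d r s f i j) := fun k => by
    rw [← MulOpposite.unop_op (L (eP K a d r s k)), ← MulOpposite.unop_op (serreEltF a d r s f i j)]
    refine MulOpposite.commute_unop.mpr (Commute.symm ?_)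
    rw [← hop]
    have hscale : ∀ (ψ : Fin n → K) (c : K) (l : Fin n),
        MulOpposite.op (c • (scaleUplus a d r s ψ).toLinearMap : Module.End K (Uplus K a d r s)) *
            MulOpposite.op (f l) =
          ψ l • (MulOpposite.op (f l) * MulOpposite.op
            (c • (scaleUplus a d r s ψ).toLinearMap : Module.End K (Uplus K a d r s))) := by
      intro ψ c l
      rw [← MulOpposite.op_mul, ← MulOpposite.op_mul, ← MulOpposite.op_smul]
      congr 1
      refine LinearMap.ext fun P => ?_
      simp [hfs, smul_smul, mul_comm]
    refine serreElt_commute (k := k) hr hs hsym (fun l => ?_)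
      (hscale (omegaChar a d r s k) ((r ^ d k - s ^ d k)⁻¹ * z k))
      (hscale (omegaChar' a d r s k) (-(r ^ d k - s ^ d k)⁻¹)) hij (hoff i j hij)
    rw [← MulOpposite.op_mul, ← MulOpposite.op_mul, ← MulOpposite.op_sub, ← MulOpposite.op_add,
      ← MulOpposite.op_zero, ← apply_ite MulOpposite.op]
    congr 1
    refine LinearMap.ext fun P => ?_
    have := hf l k P
    by_cases h : l = k
    · subst h
      simp only [if_true] at this ⊢
      refine this.trans ?_
      simp only [LinearMap.add_apply, LinearMap.smul_apply, AlgHom.toLinearMap_apply]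
      module
    · simp only [if_neg h, if_neg (Ne.symm h)] at this ⊢
      simpa [L] using this
  have hone : serreEltF a d r s f i j 1 = 0 := by
    rw [serreEltF, LinearMap.sum_apply]
    refine Finset.sum_eq_zero fun k _ => ?_
    have : (f j) ((f i ^ ((1 - a i j).toNat - k)) 1) = 0 := by
      rcases (1 - a i j).toNat - k with _ | t
      · simp [hf1]
      · simp [pow_succ, hf1]
    simp [this]
  refine linearMap_ext_of_adjoin adjoin_eP (by simpa using hone) fun l P hP => ?_
  have := LinearMap.congr_fun (hcomm l).eq P
  simp only [Module.End.mul_apply] at this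
  rw [show eP K a d r s l * P = L (eP K a d r s l) P from rfl, ← this, hP]
  simp

end skewDerivation

lemma rr_ne_zero : rr ≠ 0 :=
  (map_ne_zero_iff _ (IsFractionRing.injective _ _)).mpr (MvPolynomial.X_ne_zero 0)

lemma ss_ne_zero : ss ≠ 0 :=
  (map_ne_zero_iff _ (IsFractionRing.injective _ _)).mpr (MvPolynomial.X_ne_zero 1)

lemma rr_zpow_sub_ss_zpow_ne_zero {m : ℤ} (hm : 0 < m) : rr ^ m - ss ^ m ≠ 0 := by
  lift m to ℕ using hm.le
  rw [sub_ne_zero, zpow_natCast, zpow_natCast, rr, ss, ← map_pow, ← map_pow]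
  refine fun h => ?_
  have h := congrArg (MvPolynomial.eval ![(1 : ℚ), 0]) (IsFractionRing.injective _ K2 h)
  have hm : m ≠ 0 := by omega
  simp [hm] at h

section lowestWeightModule

variable {n : ℕ} {a : Fin n → Fin n → ℤ} {d : Fin n → ℤ}

/-- The action of the generators on the lowest weight module with lowest weight
`ω_i ↦ z i`, `ω_i' ↦ 1`, where `f` gives the action of the `f_i`. -/
def lowestWeightAction (z : Fin n → K2) (f : Fin n → Module.End K2 (Uplus K2 a d rr ss)) :
    Gen n → Module.End K2 (Uplus K2 a d rr ss)
  | .e i => Algebra.lmul K2 _ (eP K2 a d rr ss i)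
  | .f i => f i
  | .w i => z i • (scaleUplus a d rr ss (omegaChar a d rr ss i)).toLinearMap
  | .winv i => (z i)⁻¹ • (scaleUplus a d rr ss (omegaChar a d rr ss i)⁻¹).toLinearMap
  | .w' i => (scaleUplus a d rr ss (omegaChar' a d rr ss i)).toLinearMap
  | .w'inv i => (scaleUplus a d rr ss (omegaChar' a d rr ss i)⁻¹).toLinearMap

lemma lowestWeightAction_tor (z : Fin n → K2) (f : Fin n → Module.End K2 (Uplus K2 a d rr ss))
    (i : Fin n) (p q : Bool) : ∃ (c : K2) (ψ : Fin n → K2),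
      lowestWeightAction z f (tor i p q) = c • (scaleUplus a d rr ss ψ).toLinearMap := by
  cases p <;> cases q
  exacts [⟨_, _, rfl⟩, ⟨_, _, rfl⟩, ⟨1, _, (one_smul _ _).symm⟩, ⟨1, _, (one_smul _ _).symm⟩]

lemma exists_lowestWeightModule (hsym : ∀ i j, d i * a i j = d j * a j i)
    (hoff : ∀ i j, i ≠ j → a i j ≤ 0) {z : Fin n → K2} (hz : ∀ i, z i ≠ 0) :
    ∃ θ : Uq a d →ₐ[K2] Module.End K2 (Uplus K2 a d rr ss),
      (∀ l P, θ (gU a d (Gen.e l)) P = eP K2 a d rr ss l * P) ∧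
      (∀ k P, θ (gU a d (Gen.w k)) P = z k • scaleUplus a d rr ss (omegaChar a d rr ss k) P) ∧
      ∀ k P, θ (gU a d (Gen.w' k)) P = scaleUplus a d rr ss (omegaChar' a d rr ss k) P := by
  choose f hf1 hf hfs using fun k =>
    exists_lowering (a := a) (d := d) rr_ne_zero ss_ne_zero hsym hoff (z k) k
  let g := lowestWeightAction z f
  have hχ := omegaChar_ne_zero (a := a) (d := d) rr_ne_zero ss_ne_zero
  have hχ' := omegaChar'_ne_zero (a := a) (d := d) rr_ne_zero ss_ne_zero
  have hχi : ∀ k l, (omegaChar a d rr ss k)⁻¹ l ≠ 0 := fun k l => inv_ne_zero (hχ k l)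
  have hχi' : ∀ k l, (omegaChar' a d rr ss k)⁻¹ l ≠ 0 := fun k l => inv_ne_zero (hχ' k l)
  have hrel : ∀ ⦃x y⦄, URel a d x y → FreeAlgebra.lift K2 g x = FreeAlgebra.lift K2 g y := by
    intro x y h
    induction h with
    | torComm i j p q p' q' =>
      obtain ⟨c, ψ, h⟩ := lowestWeightAction_tor z f i p q
      obtain ⟨c', ψ', h'⟩ := lowestWeightAction_tor z f j p' q'
      simp only [map_mul, FreeAlgebra.lift_ι_apply, g, h, h']
      refine LinearMap.ext fun P => ?_
      simp [scaleUplus_mul_apply, mul_comm ψ, smul_smul, mul_comm c]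
    | wInvR i =>
      refine LinearMap.ext fun P => ?_
      have := scaleUplus_inv_apply (hχi i) P
      rw [inv_inv] at this
      simp [g, lowestWeightAction, this, hz]
    | wInvL i =>
      refine LinearMap.ext fun P => ?_
      simp [g, lowestWeightAction, scaleUplus_inv_apply (hχ i), hz]
    | w'InvR i =>
      refine LinearMap.ext fun P => ?_
      have := scaleUplus_inv_apply (hχi' i) P
      rw [inv_inv] at this
      simp [g, lowestWeightAction, this]
    | w'InvL i =>
      refine LinearMap.ext fun P => ?_
      simp [g, lowestWeightAction, scaleUplus_inv_apply (hχ' i)]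
    | we i j =>
      refine LinearMap.ext fun P => ?_
      rw [← omegaChar]
      simp [g, lowestWeightAction, scaleUplus_eP, smul_smul, mul_comm]
    | w'e i j =>
      refine LinearMap.ext fun P => ?_
      rw [← omegaChar']
      simp [g, lowestWeightAction, scaleUplus_eP]
    | wf i j =>
      refine LinearMap.ext fun P => ?_
      have : (rr ^ eulB a d j i)⁻¹ * ss ^ eulB a d i j = (omegaChar a d rr ss i j)⁻¹ := by
        rw [omegaChar, mul_inv, inv_inv]
      rw [this]
      simp only [map_mul, map_smul, FreeAlgebra.lift_ι_apply, g, lowestWeightAction,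
        Module.End.mul_apply, LinearMap.smul_apply, AlgHom.toLinearMap_apply, hfs, smul_smul]
      congr 1
      field_simp [hχ i j]
    | w'f i j =>
      refine LinearMap.ext fun P => ?_
      have : rr ^ eulB a d i j * (ss ^ eulB a d j i)⁻¹ = (omegaChar' a d rr ss i j)⁻¹ := by
        rw [omegaChar', mul_inv, inv_inv]
      rw [this]
      simp only [map_mul, map_smul, FreeAlgebra.lift_ι_apply, g, lowestWeightAction,
        Module.End.mul_apply, LinearMap.smul_apply, AlgHom.toLinearMap_apply, hfs, smul_smul,
        inv_mul_cancel₀ (hχ' i j), one_smul]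
    | ef i j =>
      refine LinearMap.ext fun P => ?_
      have := hf j i P
      by_cases h : i = j
      · subst h
        rw [if_pos rfl] at this ⊢
        simpa [g, lowestWeightAction] using this
      · rw [if_neg h] at this ⊢
        simpa [g, lowestWeightAction] using this
    | serreE i j h =>
      rw [map_zero, ← serreElt_lmul_eP (r := rr) (s := ss) h]
      simp [serreElt, map_sum, g, lowestWeightAction]
    | serreF i j h =>
      rw [map_zero, ← serreEltF_lowering rr_ne_zero ss_ne_zero hsym hoff hf1 hf hfs h]
      simp [serreEltF, map_sum, g, lowestWeightAction]
  let θ : Uq a d →ₐ[K2] Module.End K2 (Uplus K2 a d rr ss) :=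
    RingQuot.liftAlgHom K2 ⟨FreeAlgebra.lift K2 g, hrel⟩
  have hθ : ∀ x, θ (gU a d x) = g x := fun x => by
    rw [gU]
    exact (RingQuot.liftAlgHom_mkAlgHom_apply ..).trans (FreeAlgebra.lift_ι_apply _ _)
  exact ⟨θ, fun l P => by rw [hθ]; rfl, fun k P => by rw [hθ]; rfl, fun k P => by rw [hθ]; rfl⟩

lemma serreElt_gU {i j : Fin n} (h : i ≠ j) :
    serreElt a d rr ss (fun l => gU a d (Gen.e l)) i j = 0 := by
  have := RingQuot.mkAlgHom_rel K2 (URel.serreE (a := a) (d := d) i j h)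
  rw [map_zero] at this
  rw [← this]
  simp [serreElt, map_sum, gU]

lemma gU_e_mul_gU_f (hdpos : ∀ i, 0 < d i) (i j : Fin n) :
    (rr ^ d i - ss ^ d i) • (gU a d (Gen.e j) * gU a d (Gen.f i) -
      gU a d (Gen.f i) * gU a d (Gen.e j)) =
      if i = j then gU a d (Gen.w i) - gU a d (Gen.w' i) else 0 := by
  have h := RingQuot.mkAlgHom_rel K2 (URel.ef (a := a) (d := d) j i)
  rw [map_sub, map_mul, map_mul] at h
  change gU a d (Gen.e j) * gU a d (Gen.f i) - gU a d (Gen.f i) * gU a d (Gen.e j) = _ at h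
  rw [h]
  by_cases hij : i = j
  · subst hij
    rw [if_pos rfl, if_pos rfl, map_smul, map_sub, smul_smul,
      mul_inv_cancel₀ (rr_zpow_sub_ss_zpow_ne_zero (hdpos i)), one_smul]
    rfl
  · rw [if_neg (Ne.symm hij), if_neg hij, map_zero, smul_zero]

lemma gU_w_mul_gU_e (i j : Fin n) : gU a d (Gen.w i) * gU a d (Gen.e j) =
    omegaChar a d rr ss i j • (gU a d (Gen.e j) * gU a d (Gen.w i)) := by
  have h := RingQuot.mkAlgHom_rel K2 (URel.we (a := a) (d := d) i j)
  rwa [map_smul, map_mul, map_mul] at h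

lemma gU_w'_mul_gU_e (i j : Fin n) : gU a d (Gen.w' i) * gU a d (Gen.e j) =
    omegaChar' a d rr ss i j • (gU a d (Gen.e j) * gU a d (Gen.w' i)) := by
  have h := RingQuot.mkAlgHom_rel K2 (URel.w'e (a := a) (d := d) i j)
  rwa [map_smul, map_mul, map_mul] at h

/-- Every element of `U⁺ ⊆ U_{r,s}(𝔤)` comes from the algebra presented by the Serre relations. -/
lemma exists_liftUplus_eq {X : Uq a d} (hX : X ∈ Upos a d) :
    ∃ P : Uplus K2 a d rr ss,
      liftUplus (fun l => gU a d (Gen.e l)) (fun _ _ => serreElt_gU) P = X := by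
  have h : Upos a d ≤ (liftUplus (fun l => gU a d (Gen.e l)) (fun _ _ => serreElt_gU) :
      Uplus K2 a d rr ss →ₐ[K2] Uq a d).range := by
    refine Algebra.adjoin_le ?_
    rintro _ ⟨l, rfl⟩
    exact ⟨eP K2 a d rr ss l, liftUplus_eP _ _ l⟩
  exact h hX

/-- The sum `ω_i U⁺ + ω_i' U⁺` is direct, and `U⁺` is torsion-free under `ω_i` and `ω_i'`. -/
lemma eq_of_w_mul_add_w'_mul_eq (hsym : ∀ i j, d i * a i j = d j * a j i)
    (hoff : ∀ i j, i ≠ j → a i j ≤ 0) (i : Fin n) {X X' Y Y' : ↥(Upos a d)}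
    (h : gU a d (Gen.w i) * (X : Uq a d) + gU a d (Gen.w' i) * (Y : Uq a d) =
      gU a d (Gen.w i) * (X' : Uq a d) + gU a d (Gen.w' i) * (Y' : Uq a d)) :
    X = X' ∧ Y = Y' := by
  obtain ⟨P, hP⟩ := exists_liftUplus_eq X.2
  obtain ⟨P', hP'⟩ := exists_liftUplus_eq X'.2
  obtain ⟨Q, hQ⟩ := exists_liftUplus_eq Y.2
  obtain ⟨Q', hQ'⟩ := exists_liftUplus_eq Y'.2
  have key : ∀ z : K2, z ≠ 0 → z • scaleUplus a d rr ss (omegaChar a d rr ss i) (P - P') =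
      scaleUplus a d rr ss (omegaChar' a d rr ss i) (Q' - Q) := fun z hz => by
    obtain ⟨θ, hθe, hθw, hθw'⟩ :=
      exists_lowestWeightModule (z := fun _ => z) hsym hoff (fun _ => hz)
    have hθ : ∀ R : Uplus K2 a d rr ss,
        θ (liftUplus (fun l => gU a d (Gen.e l)) (fun _ _ => serreElt_gU) R) 1 = R := fun R => by
      refine LinearMap.congr_fun (f := LinearMap.applyₗ 1 ∘ₗ θ.toLinearMap ∘ₗ
        (liftUplus (fun l => gU a d (Gen.e l)) (fun _ _ => serreElt_gU)).toLinearMap)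
        (g := LinearMap.id) (linearMap_ext_of_adjoin adjoin_eP (by simp) fun l R hR => ?_) R
      simp only [LinearMap.comp_apply, AlgHom.toLinearMap_apply, LinearMap.applyₗ_apply_apply,
        LinearMap.id_apply] at hR ⊢
      rw [map_mul, map_mul, Module.End.mul_apply, hR, liftUplus_eP, hθe]
    have := LinearMap.congr_fun (congrArg θ h) 1
    simp only [map_add, map_mul, LinearMap.add_apply, Module.End.mul_apply, ← hP, ← hQ, ← hP',
      ← hQ', hθ, hθw, hθw'] at this
    rw [map_sub, map_sub, smul_sub, sub_eq_sub_iff_add_eq_add, this, add_comm]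
  have h1 := key 1 one_ne_zero
  have h2 := key 2 two_ne_zero
  have hP0 : scaleUplus a d rr ss (omegaChar a d rr ss i) (P - P') = 0 := by
    rw [← h1, two_smul, one_smul] at h2
    exact left_eq_add.mp h2.symm
  have hQ0 : scaleUplus a d rr ss (omegaChar' a d rr ss i) (Q' - Q) = 0 := by
    rw [← h1, hP0, smul_zero]
  have hP1 := scaleUplus_inv_apply (omegaChar_ne_zero (a := a) (d := d) rr_ne_zero ss_ne_zero i)
    (P - P')
  have hQ1 := scaleUplus_inv_apply (omegaChar'_ne_zero (a := a) (d := d) rr_ne_zero ss_ne_zero i)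
    (Q' - Q)
  rw [hP0, map_zero] at hP1
  rw [hQ0, map_zero] at hQ1
  exact ⟨Subtype.ext (by rw [← hP, ← hP', sub_eq_zero.mp hP1.symm]),
    Subtype.ext (by rw [← hQ, ← hQ', sub_eq_zero.mp hQ1.symm])⟩

lemma skew_bracket_mul {K A : Type} [Field K] [Ring A] [Algebra K A]
    {e f w w' P X Y X' Y' : A} {c t t' δ : K} (hP : c • (P * f - f * P) = w * X - w' * Y)
    (heP : c • (e * P * f - f * (e * P)) = w * X' - w' * Y')
    (hef : c • (e * f - f * e) = δ • (w - w')) (ht : t ≠ 0) (ht' : t' ≠ 0)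
    (hw : w * e = t • (e * w)) (hw' : w' * e = t' • (e * w')) :
    w * X' + w' * (t'⁻¹ • (e * Y) + δ • P) = w * (t⁻¹ • (e * X) + δ • P) + w' * Y' := by
  have hsplit : c • (e * P * f - f * (e * P)) =
      e * (c • (P * f - f * P)) + (c • (e * f - f * e)) * P := by
    rw [mul_smul_comm, smul_mul_assoc, ← smul_add]
    congr 1
    noncomm_ring
  have hw : e * w = t⁻¹ • (w * e) := by rw [hw, inv_smul_smul₀ ht]
  have hw' : e * w' = t'⁻¹ • (w' * e) := by rw [hw', inv_smul_smul₀ ht']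
  rw [hsplit, hP, hef, mul_sub, ← mul_assoc, ← mul_assoc, hw, hw'] at heP
  simp only [mul_add, sub_mul, smul_mul_assoc, mul_smul_comm, mul_assoc, smul_sub] at heP ⊢
  rw [sub_eq_iff_eq_add.mp heP.symm]
  abel

/-- The skew Leibniz rules for `∂_i` and `∂_i'` against left multiplication by `e_j`. -/
lemma skewDerivative_mul (hoff : ∀ i j, i ≠ j → a i j ≤ 0)
    (hsym : ∀ i j, d i * a i j = d j * a j i) (hdpos : ∀ i, 0 < d i)
    {D D' : Fin n → (↥(Upos a d) →ₗ[K2] ↥(Upos a d))}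
    (hD : ∀ (i : Fin n) (P : ↥(Upos a d)),
      (rr ^ d i - ss ^ d i) •
          ((P : Uq a d) * gU a d (Gen.f i) - gU a d (Gen.f i) * (P : Uq a d)) =
        gU a d (Gen.w i) * (D i P : Uq a d) - gU a d (Gen.w' i) * (D' i P : Uq a d))
    (i j : Fin n) (P : ↥(Upos a d)) :
    D i (eUp a d j * P) = (omegaChar a d rr ss i j)⁻¹ • (eUp a d j * D i P) +
        (if i = j then (1 : K2) else 0) • P ∧
      D' i (eUp a d j * P) = (omegaChar' a d rr ss i j)⁻¹ • (eUp a d j * D' i P) +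
        (if i = j then (1 : K2) else 0) • P := by
  have hef : (rr ^ d i - ss ^ d i) • (gU a d (Gen.e j) * gU a d (Gen.f i) -
      gU a d (Gen.f i) * gU a d (Gen.e j)) =
      (if i = j then (1 : K2) else 0) • (gU a d (Gen.w i) - gU a d (Gen.w' i)) := by
    rw [gU_e_mul_gU_f hdpos]
    split_ifs
    · rw [one_smul]
    · rw [zero_smul]
  have h := skew_bracket_mul (A := Uq a d) (hD i P) (hD i (eUp a d j * P)) hef
    (omegaChar_ne_zero rr_ne_zero ss_ne_zero i j) (omegaChar'_ne_zero rr_ne_zero ss_ne_zero i j)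
    (gU_w_mul_gU_e i j) (gU_w'_mul_gU_e i j)
  obtain ⟨hX, hY⟩ := eq_of_w_mul_add_w'_mul_eq hsym hoff i (X := D i (eUp a d j * P))
    (X' := (omegaChar a d rr ss i j)⁻¹ • (eUp a d j * D i P) + (if i = j then (1 : K2) else 0) • P)
    (Y := (omegaChar' a d rr ss i j)⁻¹ • (eUp a d j * D' i P) +
      (if i = j then (1 : K2) else 0) • P) (Y' := D' i (eUp a d j * P)) h
  exact ⟨hX, hY.symm⟩

end lowestWeightModule

lemma pow_mul_of_mul_eq_smul_mul_add {K B : Type} [Field K] [Semiring B] [Algebra K B] {x y : B}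
    {t c : K} (h : x * y = t • (y * x) + c • (1 : B)) (m : ℕ) :
    x ^ (m + 1) * y = t ^ (m + 1) • (y * x ^ (m + 1)) + (c * qnat t (m + 1)) • x ^ m := by
  induction m with
  | zero => simpa [qnat] using h
  | succ m ih =>
    rw [pow_succ' x (m + 1), mul_assoc, ih, mul_add, mul_smul_comm, mul_smul_comm, ← mul_assoc x y,
      h, add_mul, smul_mul_assoc, smul_mul_assoc, one_mul, smul_add, smul_smul, smul_smul,
      mul_assoc y, ← pow_succ', ← pow_succ', add_assoc, ← add_smul, ← pow_succ,
      add_comm (t ^ (m + 1) * c), mul_comm (t ^ (m + 1)) c, qnat_succ t (m + 1), mul_add]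

set_option synthInstance.maxHeartbeats 1000000
set_option maxHeartbeats 1000000

/-- **Lemma 4.2 (second and third relations).**
`∂_i^m E_j = r^{-m⟨α_j,α_i⟩} s^{m⟨α_i,α_j⟩} E_j ∂_i^m + δ_{ij} (m)_{r_i⁻¹ s_i} ∂_i^{m-1}`
and
`∂_i'^m E_j = r^{m⟨α_i,α_j⟩} s^{-m⟨α_j,α_i⟩} E_j ∂_i'^m + δ_{ij} (m)_{r_i s_i⁻¹} ∂_i'^{m-1}`,
where `E_j` is left multiplication by `e_j` on `U⁺`. -/
theorem skew_derivative_power_mulLeft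
    (n : ℕ) (a : Fin n → Fin n → ℤ) (d : Fin n → ℤ)
    (hdiag : ∀ i, a i i = 2) (hoff : ∀ i j, i ≠ j → a i j ≤ 0)
    (hsym : ∀ i j, d i * a i j = d j * a j i) (hdpos : ∀ i, 0 < d i)
    (hfin : Matrix.PosDef (Matrix.of fun i j : Fin n => ((d i * a i j : ℤ) : ℝ)))
    (D D' : Fin n → (↥(Upos a d) →ₗ[K2] ↥(Upos a d)))
    (hD : ∀ (i : Fin n) (P : ↥(Upos a d)),
      (rr ^ d i - ss ^ d i) •
          ((P : Uq a d) * gU a d (Gen.f i) - gU a d (Gen.f i) * (P : Uq a d)) =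
        gU a d (Gen.w i) * (D i P : Uq a d) - gU a d (Gen.w' i) * (D' i P : Uq a d)) :
    ∀ (i j : Fin n) (m : ℕ), 1 ≤ m →
      (D i ^ m) ∘ₗ LinearMap.mulLeft K2 (eUp a d j) =
        ((rr ^ ((m : ℤ) * eulB a d j i))⁻¹ * ss ^ ((m : ℤ) * eulB a d i j)) •
            (LinearMap.mulLeft K2 (eUp a d j) ∘ₗ (D i ^ m)) +
          (if i = j then qnat ((rr ^ d i)⁻¹ * ss ^ d i) m else 0) • (D i ^ (m - 1)) ∧
      (D' i ^ m) ∘ₗ LinearMap.mulLeft K2 (eUp a d j) =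
        (rr ^ ((m : ℤ) * eulB a d i j) * (ss ^ ((m : ℤ) * eulB a d j i))⁻¹) •
            (LinearMap.mulLeft K2 (eUp a d j) ∘ₗ (D' i ^ m)) +
          (if i = j then qnat (rr ^ d i * (ss ^ d i)⁻¹) m else 0) • (D' i ^ (m - 1)) := by
  have key := skewDerivative_mul hoff hsym hdpos hD
  intro i j m hm
  obtain ⟨m, rfl⟩ := Nat.exists_eq_add_of_le' hm
  have h : D i * LinearMap.mulLeft K2 (eUp a d j) =
      (omegaChar a d rr ss i j)⁻¹ • (LinearMap.mulLeft K2 (eUp a d j) * D i) +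
        (if i = j then (1 : K2) else 0) • (1 : Module.End K2 ↥(Upos a d)) :=
    LinearMap.ext fun P => (key i j P).1
  have h' : D' i * LinearMap.mulLeft K2 (eUp a d j) =
      (omegaChar' a d rr ss i j)⁻¹ • (LinearMap.mulLeft K2 (eUp a d j) * D' i) +
        (if i = j then (1 : K2) else 0) • (1 : Module.End K2 ↥(Upos a d)) :=
    LinearMap.ext fun P => (key i j P).2
  constructor
  · refine (pow_mul_of_mul_eq_smul_mul_add (B := Module.End K2 ↥(Upos a d)) h m).trans ?_
    congr 2
    · rw [omegaChar, mul_inv, inv_inv, mul_pow, inv_pow, mul_comm ((m + 1 : ℕ) : ℤ),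
        mul_comm ((m + 1 : ℕ) : ℤ), zpow_mul, zpow_mul, zpow_natCast, zpow_natCast]
    · split_ifs with hij
      · rw [← hij, omegaChar_self, mul_inv, inv_inv, one_mul]
      · rw [zero_mul]
  · refine (pow_mul_of_mul_eq_smul_mul_add (B := Module.End K2 ↥(Upos a d)) h' m).trans ?_
    congr 2
    · rw [omegaChar', mul_inv, inv_inv, mul_pow, inv_pow, mul_comm ((m + 1 : ℕ) : ℤ),
        mul_comm ((m + 1 : ℕ) : ℤ), zpow_mul, zpow_mul, zpow_natCast, zpow_natCast]
    · split_ifs with hij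
      · rw [← hij, omegaChar'_self, inv_inv, one_mul]
      · rw [zero_mul]

end
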